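/- arXiv:2210.11564 — 2 statements merged into one kernel-verified Lean document; each statement's English description precedes it below -/
import Mathlib

section
/- Let G be a finite insoluble group and suppose that for some x ∈ G the set Sol_G(x) is the underlying set of a 2-subgroup of G (i.e. a subgroup whose order is a power of 2). Then this subgroup is nonabelian and has order at least 16. -/
/-- The solubilizer of an element `x` of a group `G`: the set of all `y ∈ G`
such that the subgroup generated by `x` and `y` is soluble. -/
def solubilizer {G : Type*} [Group G] (x : G) : Set G :=
  {y | IsSolvable ↥(Subgroup.closure ({x, y} : Set G))}

open Subgroup Pointwise
open scoped commutatorElement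

theorem Subgroup.isSolvable_sup_of_le_normalizer {G : Type*} [Group G] {H N : Subgroup G}
    (h : H ≤ normalizer N) [Group.IsSolvable H] [Group.IsSolvable N] :
    Group.IsSolvable ↥(H ⊔ N) := by
  have hle : H ⊔ N ≤ normalizer N := sup_le h le_normalizer
  have := normal_subgroupOf_of_le_normalizer hle
  have := Group.isSolvable_of_isSolvable_injective
    (f := (subgroupOfEquivOfLe (le_sup_right : N ≤ H ⊔ N)).toMonoidHom)
    (subgroupOfEquivOfLe (le_sup_right : N ≤ H ⊔ N)).injective
  have := normal_subgroupOf_of_le_normalizer h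
  have := Group.isSolvable_of_surjective
    (f := (QuotientGroup.quotientInfEquivProdNormalizerQuotient H N h).toMonoidHom)
    (QuotientGroup.quotientInfEquivProdNormalizerQuotient H N h).surjective
  exact (Group.isSolvable_iff_subgroup_quotient (N.subgroupOf (H ⊔ N))).2 ⟨‹_›, ‹_›⟩

theorem Subgroup.relIndex_sup_of_normal {G : Type*} [Group G] [Finite G] (H K : Subgroup G)
    [K.Normal] : H.relIndex (H ⊔ K) = H.relIndex K := by
  have h₁ := relIndex_mul_relIndex (H ⊓ K) H (H ⊔ K) inf_le_left le_sup_left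
  have h₂ := relIndex_mul_relIndex (H ⊓ K) K (H ⊔ K) inf_le_right le_sup_right
  rw [inf_relIndex_right, relIndex_sup_right, ← h₁, inf_relIndex_left, mul_comm] at h₂
  exact (Nat.eq_of_mul_eq_mul_left (Nat.pos_of_ne_zero FiniteIndex.index_ne_zero) h₂).symm

section solubilizer

variable {G : Type*} [Group G] {x : G} {S : Subgroup G}

theorem le_of_solubilizer_subset (h : solubilizer x ⊆ S) {T : Subgroup G} [Group.IsSolvable T]
    (hx : x ∈ T) : T ≤ S := by
  intro y hy
  have hle : closure {x, y} ≤ T := by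
    rw [closure_le]
    rintro z (rfl | rfl) <;> assumption
  exact h (Group.isSolvable_of_isSolvable_injective (inclusion_injective hle))

theorem mem_of_solubilizer_subset (h : solubilizer x ⊆ S) : x ∈ S :=
  have : Group.IsSolvable (zpowers x) := Group.isSolvable_of_comm fun a b => Subtype.ext (setLike_mul_comm a.2 b.2)
  le_of_solubilizer_subset h (mem_zpowers x) (mem_zpowers x)

theorem solubilizer_subset_subgroupOf (h : solubilizer x ⊆ S) {H : Subgroup G} (hx : x ∈ H) :
    solubilizer (⟨x, hx⟩ : H) ⊆ S.subgroupOf H := by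
  intro y hy
  have hy' : Group.IsSolvable (closure {(⟨x, hx⟩ : H), y}) := hy
  have hmap : Group.IsSolvable ((closure {(⟨x, hx⟩ : H), y}).map H.subtype) :=
    Group.isSolvable_of_surjective (H.subtype.subgroupMap_surjective _)
  exact le_of_solubilizer_subset h (T := (closure {(⟨x, hx⟩ : H), y}).map H.subtype)
    ⟨_, subset_closure (Set.mem_insert _ _), rfl⟩ ⟨y, subset_closure (by simp), rfl⟩

theorem solubilizer_mk_subset_map (h : solubilizer x ⊆ S) (R : Subgroup G) [R.Normal]
    [Group.IsSolvable R] : solubilizer (x : G ⧸ R) ⊆ S.map (QuotientGroup.mk' R) := by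
  intro y hy
  obtain ⟨y, rfl⟩ := QuotientGroup.mk_surjective y
  have hy' : Group.IsSolvable (closure {(x : G ⧸ R), (y : G ⧸ R)}) := hy
  let C := (closure {(x : G ⧸ R), (y : G ⧸ R)}).comap (QuotientGroup.mk' R)
  have hRC : R ≤ C := by
    intro r hr
    simp only [C, mem_comap, QuotientGroup.mk'_apply, (QuotientGroup.eq_one_iff r).2 hr, one_mem]
  have : Group.IsSolvable C := by
    refine Group.isSolvable_of_ker_le_range (inclusion hRC)
      ((QuotientGroup.mk' R).subgroupComap (closure {(x : G ⧸ R), (y : G ⧸ R)})) ?_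
    intro c hc
    have : (QuotientGroup.mk' R) c = 1 := congrArg Subtype.val hc
    exact ⟨⟨c, (QuotientGroup.eq_one_iff _).1 this⟩, rfl⟩
  exact ⟨y, le_of_solubilizer_subset h (T := C) (subset_closure (by simp))
    (subset_closure (by simp)), rfl⟩

theorem normalizer_le_of_solubilizer_subset [Finite G] (h : solubilizer x ⊆ S)
    [Group.IsSolvable S] : normalizer S ≤ S := by
  intro y hy
  have := isSolvable_sup_of_le_normalizer (H := zpowers y) (N := S) (by simpa using hy)
  exact le_of_solubilizer_subset h (T := zpowers y ⊔ S)
    (mem_sup_right (mem_of_solubilizer_subset h)) (mem_sup_left (mem_zpowers y))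

theorem IsPGroup.isSolvable {p : ℕ} [Fact p.Prime] {H : Type*} [Group H] [Finite H]
    (hH : IsPGroup p H) : Group.IsSolvable H :=
  have := hH.isNilpotent
  inferInstance

theorem not_dvd_index_of_solubilizer_subset [Finite G] {p : ℕ} [Fact p.Prime] (hS : IsPGroup p S)
    (h : solubilizer x ⊆ S) : ¬ p ∣ S.index := by
  obtain ⟨P, hP⟩ := hS.exists_le_sylow
  have := P.2.isSolvable
  rw [le_antisymm hP (le_of_solubilizer_subset h (hP (mem_of_solubilizer_subset h)))]
  exact P.not_dvd_index

theorem eq_bot_of_solubilizer_subset [Finite G] {p : ℕ} [Fact p.Prime] (hS : IsPGroup p S)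
    (h : solubilizer x ⊆ S) (N : Subgroup G) [N.Normal] (hN : ¬ p ∣ Nat.card N) : N = ⊥ := by
  by_contra hne
  have hq : (Nat.card N).minFac.Prime :=
    Nat.minFac_prime fun h1 => hne (card_eq_one.1 h1)
  have : Fact (Nat.card N).minFac.Prime := ⟨hq⟩
  let Q : Sylow (Nat.card N).minFac N := default
  have hQ : (Q : Subgroup N) ≠ ⊥ := Q.ne_bot_of_dvd_card (Nat.minFac_dvd _)
  let R := (Q : Subgroup N).map N.subtype
  have hR : IsPGroup _ R := Q.2.map N.subtype
  have hF : normalizer (R : Set G) ⊔ N = ⊤ := Q.normalizer_sup_eq_top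
  have hindex : ¬ p ∣ (normalizer (R : Set G)).index := by
    rw [← relIndex_top_right, ← hF, relIndex_sup_of_normal]
    exact fun hd => hN (hd.trans (relIndex_dvd_card _ _))
  obtain ⟨g, hg⟩ := hS.nonempty_fixed_point_of_prime_not_dvd_card (G ⧸ normalizer (R : Set G)) hindex
  obtain ⟨g, rfl⟩ := QuotientGroup.mk_surjective g
  have hx : g⁻¹ * x * g ∈ normalizer (R : Set G) := by
    have := QuotientGroup.eq.1 (hg ⟨x⁻¹, inv_mem (mem_of_solubilizer_subset h)⟩)
    simpa [mul_assoc] using this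
  have hR' : IsPGroup _ ↥(MulAut.conj g • R) := hR.map _
  have := hR'.isSolvable
  have hxR : zpowers x ≤ normalizer ((MulAut.conj g • R : Subgroup G) : Set G) := by
    rw [zpowers_le, mem_normalizer_iff]
    rw [mem_normalizer_iff] at hx
    intro y
    rw [mem_pointwise_smul_iff_inv_smul_mem, mem_pointwise_smul_iff_inv_smul_mem]
    convert! hx (g⁻¹ * y * g) using 2
    simp [← map_inv, mul_assoc]
  have := isSolvable_sup_of_le_normalizer hxR
  have hle : MulAut.conj g • R ≤ S := le_sup_right.trans
    (le_of_solubilizer_subset h (T := zpowers x ⊔ MulAut.conj g • R)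
      (mem_sup_left (mem_zpowers x)))
  have hdisj : Disjoint S N := by
    rw [disjoint_iff, ← card_eq_one]
    refine ((hS.to_le inf_le_left : IsPGroup p ↥(S ⊓ N)).card_eq_or_dvd).resolve_right ?_
    exact fun hd => hN (hd.trans (card_dvd_of_le inf_le_right))
  refine hQ ((eq_bot_iff_forall _).2 fun q hq => ?_)
  have hgq : g * q * g⁻¹ ∈ S := hle ⟨q, ⟨q, hq, rfl⟩, rfl⟩
  have := disjoint_def.1 hdisj hgq (Normal.conj_mem ‹_› _ q.2 g)
  simpa using this

theorem le_of_solubilizer_subset_of_isMulCommutative [Finite G] {p : ℕ} [Fact p.Prime]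
    (hS : IsPGroup p S) (h : solubilizer x ⊆ S) (K : Subgroup G) [K.Normal]
    (hK : normalizer ((S ⊓ K : Subgroup G) : Set G) ⊓ K ≤ S) (hcomm : IsMulCommutative ↥(S ⊓ K)) :
    K ≤ S := by
  have hindex : ¬ p ∣ (S.subgroupOf K).index := by
    change ¬ p ∣ S.relIndex K
    rw [← relIndex_sup_of_normal]
    exact fun hd => not_dvd_index_of_solubilizer_subset hS h
      (hd.trans (relIndex_dvd_index_of_le le_sup_left))
  let T : Sylow p K := (hS.comap_of_injective K.subtype K.subtype_injective).toSylow hindex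
  have hTdef : (T : Subgroup K) = S.subgroupOf K := rfl
  have hT : normalizer (T : Set K) ≤ centralizer (T : Set K) := by
    intro y hy z hz
    have hyS : (y : G) ∈ S := by
      refine hK ⟨mem_normalizer_iff.2 fun w => ?_, y.2⟩
      by_cases hw : w ∈ K
      · have hw' : (y : G) * w * (y : G)⁻¹ ∈ K := Normal.conj_mem ‹_› _ hw _
        have := mem_normalizer_iff.1 hy ⟨w, hw⟩
        simpa [hTdef, mem_subgroupOf, hw, hw'] using this
      · have hw' : (y : G) * w * (y : G)⁻¹ ∉ K := fun hh => hw (by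
          simpa [mul_assoc] using Normal.conj_mem ‹_› _ hh (y : G)⁻¹)
        simp [hw, hw']
    have := hcomm.is_comm.comm ⟨z, hz, z.2⟩ ⟨y, hyS, y.2⟩
    exact Subtype.ext (congrArg (fun w : ↥(S ⊓ K) => (w : G)) this)
  let M := (MonoidHom.transferSylow T hT).ker
  have hM : ¬ p ∣ Nat.card M := MonoidHom.not_dvd_card_ker_transferSylow T hT
  have hmem (m : K) : m ∈ M ↔ ¬ p ∣ orderOf m := by
    refine ⟨fun hm hd => hM (hd.trans (M.orderOf_dvd_natCard hm)), fun hm => ?_⟩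
    obtain ⟨n, hn⟩ := IsPGroup.iff_orderOf.1 T.2 (MonoidHom.transferSylow T hT m)
    have hd := orderOf_map_dvd (MonoidHom.transferSylow T hT) m
    rw [MonoidHom.mem_ker, ← orderOf_eq_one_iff, hn]
    rcases n with _ | n
    · simp
    · exact (hm (((dvd_pow_self p n.succ_ne_zero).trans (hn ▸ dvd_rfl)).trans hd)).elim
  have hnormal : (M.map K.subtype).Normal := by
    refine ⟨?_⟩
    rintro _ ⟨m, hm, rfl⟩ g
    refine ⟨⟨g * m * g⁻¹, Normal.conj_mem ‹_› _ m.2 g⟩, ?_, rfl⟩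
    have : orderOf (⟨g * m * g⁻¹, Normal.conj_mem ‹_› _ m.2 g⟩ : K) = orderOf m :=
      orderOf_injective (MulAut.conjNormal g : MulAut K).toMonoidHom
        (MulAut.conjNormal g : MulAut K).injective m
    rw [SetLike.mem_coe, hmem] at hm ⊢
    rwa [this]
  have hbot := eq_bot_of_solubilizer_subset hS h (M.map K.subtype)
    (by rwa [card_map_of_injective K.subtype_injective])
  rw [map_eq_bot_iff_of_injective _ K.subtype_injective] at hbot
  have hcompl := MonoidHom.ker_transferSylow_isComplement' T hT
  change IsComplement' M _ at hcompl
  rw [hbot, isComplement'_bot_left] at hcompl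
  exact subgroupOf_eq_top.1 hcompl

theorem eq_top_of_solubilizer_subset_of_isMulCommutative [Finite G] {p : ℕ} [Fact p.Prime]
    (hS : IsPGroup p S) (h : solubilizer x ⊆ S) (hcomm : IsMulCommutative S) : S = ⊤ := by
  have := hS.isSolvable
  refine top_le_iff.1 (le_of_solubilizer_subset_of_isMulCommutative hS h ⊤ ?_ ?_)
  · simpa using normalizer_le_of_solubilizer_subset h
  · rwa [inf_top_eq]

theorem normalizer_le_of_commutator_le [Finite G] {p : ℕ} [Fact p.Prime]
    (hS : IsPGroup p S) (h : solubilizer x ⊆ S) {R : Subgroup G} (hRS : R ≤ S)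
    (hSR : S ≤ normalizer R) (hcomm : ⁅S, S⁆ ≤ R) : normalizer R ≤ S := by
  have hx : x ∈ normalizer (R : Set G) := hSR (mem_of_solubilizer_subset h)
  let H := normalizer (R : Set G)
  have : Group.IsSolvable (R.subgroupOf H) :=
    ((hS.to_le hRS).comap_of_injective H.subtype H.subtype_injective).isSolvable
  have hQ := solubilizer_mk_subset_map (solubilizer_subset_subgroupOf h (H := H) hx)
    (R.subgroupOf H)
  have htop := eq_top_of_solubilizer_subset_of_isMulCommutative (p := p)
    ((hS.comap_of_injective H.subtype H.subtype_injective).map _) hQ ⟨⟨by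
      rintro ⟨_, a, ha, rfl⟩ ⟨_, b, hb, rfl⟩
      refine Subtype.ext (QuotientGroup.eq.2 ?_)
      have := hcomm (commutator_mem_commutator (inv_mem hb) (inv_mem ha))
      simpa [mem_subgroupOf, commutatorElement_def, mul_assoc] using this⟩⟩
  intro y hy
  obtain ⟨s, hs, hsy⟩ := htop.ge (mem_top ((⟨y, hy⟩ : H) : H ⧸ R.subgroupOf H))
  have : (s : G)⁻¹ * y ∈ R := (QuotientGroup.eq (s := R.subgroupOf H)).1 hsy
  exact (mul_inv_cancel_left (s : G) y) ▸ mul_mem (show (s : G) ∈ S from hs) (hRS this)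

end solubilizer

section OrderEight

theorem isMulCommutative_of_card_dvd_four {H : Type*} [Group H] (hH : Nat.card H ∣ 4) :
    IsMulCommutative H := by
  have : Finite H := Nat.finite_of_card_ne_zero (by rintro h; simp [h] at hH)
  obtain ⟨k, hk, hcard⟩ := (Nat.dvd_prime_pow Nat.prime_two).1 (show Nat.card H ∣ 2 ^ 2 from hH)
  interval_cases k
  · have := (Nat.card_eq_one_iff_unique.1 hcard).1
    exact ⟨⟨fun a b => Subsingleton.elim _ _⟩⟩
  · have := isCyclic_of_prime_card (p := 2) hcard
    infer_instance
  · exact IsPGroup.isMulCommutative_of_card_eq_prime_sq hcard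

theorem commutator_le_of_card_eq_eight {H : Type*} [Group H] (hH : Nat.card H = 8)
    (R : Subgroup H) [R.Normal] (hR : R ≠ ⊥) : commutator H ≤ R := by
  refine Normal.quotient_commutative_iff_commutator_le.1 (isMulCommutative_of_card_dvd_four ?_)
  have hmul := R.card_mul_index
  have hne := mt card_eq_one.1 hR
  rw [hH] at hmul
  have : R.index ∣ 2 ^ 3 := ⟨_, by rw [mul_comm R.index, hmul]; norm_num⟩
  obtain ⟨k, hk, hcard⟩ := (Nat.dvd_prime_pow Nat.prime_two).1 this
  change R.index ∣ 4
  rw [hcard] at hmul ⊢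
  interval_cases k <;> omega

theorem four_le_card_centralizer {H : Type*} [Group H] (hH : Nat.card H = 8) (u : H) :
    4 ≤ Nat.card (centralizer {u}) := by
  have : Finite H := Nat.finite_of_card_ne_zero (by simp [hH])
  have : Nontrivial H := Finite.one_lt_card_iff_nontrivial.1 (by simp [hH])
  have hP : IsPGroup 2 H := IsPGroup.of_card (n := 3) hH
  by_cases hu : u ∈ center H
  · rw [centralizer_eq_top_iff_subset.2 (by simpa using hu), card_top, hH]
    norm_num
  have hlt : center H < centralizer {u} := by
    refine lt_of_le_of_ne (center_le_centralizer _) fun he => hu ?_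
    rw [he, mem_centralizer_singleton_iff]
  have h₁ : Nat.card (center H) < Nat.card (centralizer {u}) :=
    Set.ncard_lt_ncard hlt
  have h₂ : 1 < Nat.card (center H) :=
    (Finite.one_lt_card_iff_nontrivial).2 hP.center_nontrivial
  obtain ⟨k, hk, hcard⟩ := (Nat.dvd_prime_pow Nat.prime_two).1
    (show Nat.card (centralizer {u}) ∣ 2 ^ 3 from (card_subgroup_dvd_card _).trans hH.dvd)
  rw [hcard] at h₁ ⊢
  interval_cases k <;> omega

theorem focalSubgroup_le_commutator_of_conj {G : Type*} [Group G] {S : Subgroup G}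
    (hconj : ∀ u ∈ S, ∀ g : G, g * u * g⁻¹ ∈ S → ∃ k ∈ S, k * u * k⁻¹ = g * u * g⁻¹) :
    focalSubgroup S ≤ ⁅S, S⁆ := by
  rw [focalSubgroup_def, closure_le]
  rintro _ ⟨hmem, a, ha, g, rfl⟩
  have hg : g * a⁻¹ * g⁻¹ ∈ S := by
    simpa [commutatorElement_def, mul_assoc] using mul_mem (inv_mem ha) hmem
  obtain ⟨k, hk, hkg⟩ := hconj _ (inv_mem ha) g hg
  have : ⁅a, g⁆ = ⁅a, k⁆ := by
    simp only [commutatorElement_def, mul_assoc] at hkg ⊢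
    rw [hkg]
  rw [this]
  exact commutator_mem_commutator ha hk

variable {G : Type*} [Group G] [Finite G]

theorem le_normalizer_of_four_le_card {D T : Subgroup G} (hDT : D ≤ T) (hT : Nat.card T ∣ 8)
    (hD : 4 ≤ Nat.card D) : T ≤ normalizer D := by
  rw [← normal_subgroupOf_iff_le_normalizer hDT]
  have hmul : Nat.card D * D.relIndex T = Nat.card T := by
    rw [← relIndex_bot_left, ← relIndex_bot_left]
    exact relIndex_mul_relIndex _ _ _ bot_le hDT
  have hle := Nat.le_of_dvd (by norm_num) hT
  have hpos : D.relIndex T ≠ 0 := FiniteIndex.index_ne_zero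
  have : D.relIndex T = 1 ∨ D.relIndex T = 2 := by
    have : D.relIndex T ≤ 2 := by nlinarith
    omega
  rcases this with h | h
  · rw [index_eq_one.1 h]
    infer_instance
  · exact normal_of_index_eq_two h

variable {S : Subgroup G}

theorem exists_mem_conj_eq_of_card_eq_eight (hcard : Nat.card S = 8) (hindex : ¬ 2 ∣ S.index)
    (hN : ∀ R ≤ S, R ≠ ⊥ → S ≤ normalizer R → normalizer R ≤ S)
    {u g : G} (hu : u ∈ S) (hg : g * u * g⁻¹ ∈ S) : ∃ k ∈ S, k * u * k⁻¹ = g * u * g⁻¹ := by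
  have hS : IsPGroup 2 S := IsPGroup.of_card (n := 3) hcard
  have key : ∀ {D T : Subgroup G}, D ≤ T → D ≤ S → Nat.card T ∣ 8 → 4 ≤ Nat.card D → T ≤ S := by
    intro D T hDT hDS hT hD
    refine (le_normalizer_of_four_le_card hDT hT hD).trans
      (hN D hDS ?_ (le_normalizer_of_four_le_card hDS hcard.dvd hD))
    rintro rfl
    simp at hD
  have hdvd (T : Subgroup G) (hT : IsPGroup 2 T) : Nat.card T ∣ 8 := by
    obtain ⟨P, hP⟩ := hT.exists_le_sylow
    have := (hS.toSylow hindex).card_eq_multiplicity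
    rw [IsPGroup.toSylow_coe, hcard, ← P.card_eq_multiplicity] at this
    exact this ▸ card_dvd_of_le hP
  have hD (w : G) (hw : w ∈ S) : 4 ≤ Nat.card ↥(S ⊓ centralizer {w}) := by
    refine (four_le_card_centralizer hcard ⟨w, hw⟩).trans_eq ?_
    rw [← Nat.card_congr (subgroupOfEquivOfLe (inf_le_left : S ⊓ centralizer {w} ≤ S)).toEquiv]
    congr 3
    ext s
    simp [mem_subgroupOf, mem_centralizer_singleton_iff, Subtype.ext_iff]
  let v := g * u * g⁻¹
  have hDv : IsPGroup 2 ↥((S ⊓ centralizer {v}).subgroupOf (centralizer {v})) :=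
    (hS.to_le inf_le_left).comap_of_injective _ (subtype_injective _)
  let B : Sylow 2 (centralizer {v}) :=
    { (S ⊓ centralizer {v}).subgroupOf (centralizer {v}) with
      isPGroup' := hDv
      is_maximal' := by
        intro T hT hle
        refine le_antisymm (fun t ht => ⟨?_, t.2⟩) hle
        refine key (D := S ⊓ centralizer {v}) (T := T.map (Subgroup.subtype _)) ?_ inf_le_left
          (hdvd _ (hT.map _)) (hD v hg) ⟨t, ht, rfl⟩
        exact fun w hw => ⟨⟨w, hw.2⟩, hle hw, rfl⟩ }
  let A := MulAut.conj g • (S ⊓ centralizer {u})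
  have hA : IsPGroup 2 A := (hS.to_le inf_le_left).map _
  have hAC : A ≤ centralizer {v} := by
    rintro _ ⟨a, ha, rfl⟩
    have := mem_centralizer_singleton_iff.1 ha.2
    rw [mem_centralizer_singleton_iff]
    simp only [v, MulDistribMulAction.toMonoidEnd_apply, MulDistribMulAction.toMonoidHom_apply,
      MulAut.smul_def, MulAut.conj_apply, conj_mul, this]
  obtain ⟨P, hP⟩ := (hA.comap_of_injective (centralizer {v}).subtype
    (subtype_injective _)).exists_le_sylow
  obtain ⟨h, hh⟩ := MulAction.exists_smul_eq (centralizer {v}) P B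
  let k : G := h * g
  have hkv : k * u * k⁻¹ = v := by
    have := mem_centralizer_singleton_iff.1 h.2
    calc k * u * k⁻¹ = h * v * (h : G)⁻¹ := by simp [k, v, mul_assoc]
      _ = v := by rw [this, mul_inv_cancel_right]
  have hkS : MulAut.conj k • (S ⊓ centralizer {u}) ≤ S := by
    rintro _ ⟨a, ha, rfl⟩
    have haA : g * a * g⁻¹ ∈ A := ⟨a, ha, rfl⟩
    have : h * ⟨g * a * g⁻¹, hAC haA⟩ * h⁻¹ ∈ B := by
      rw [← hh]
      exact ⟨⟨g * a * g⁻¹, hAC haA⟩, hP haA, rfl⟩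
    have : (h : G) * (g * a * g⁻¹) * (h : G)⁻¹ ∈ S := this.1
    simpa [k, mul_assoc] using this
  have hcardk (D : Subgroup G) : Nat.card ↥(MulAut.conj k • D) = Nat.card D :=
    Nat.card_congr (equivSMul (MulAut.conj k) D).toEquiv.symm
  have hle : MulAut.conj k • S ≤ S := by
    refine key (D := MulAut.conj k • (S ⊓ centralizer {u})) ?_ hkS ?_ ?_
    · exact pointwise_smul_le_pointwise_smul_iff.2 inf_le_left
    · rw [hcardk, hcard]
    · rw [hcardk]
      exact hD u hu
  have heq := eq_of_le_of_card_ge hle (hcardk S).ge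
  refine ⟨k, hN S le_rfl ?_ le_normalizer (mem_normalizer_iff_map_conj_eq.2 heq), hkv⟩
  rintro rfl
  simp at hcard

theorem eq_top_of_solubilizer_subset_of_card_eq_eight {x : G} (hcard : Nat.card S = 8)
    (h : solubilizer x ⊆ S) : S = ⊤ := by
  have hS : IsPGroup 2 S := IsPGroup.of_card (n := 3) hcard
  by_cases hcomm : IsMulCommutative S
  · exact eq_top_of_solubilizer_subset_of_isMulCommutative hS h hcomm
  have hindex := not_dvd_index_of_solubilizer_subset hS h
  have hN : ∀ R ≤ S, R ≠ ⊥ → S ≤ normalizer R → normalizer R ≤ S := by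
    intro R hRS hR hSR
    refine normalizer_le_of_commutator_le hS h hRS hSR ?_
    have := (normal_subgroupOf_iff_le_normalizer hRS).2 hSR
    have hle := commutator_le_of_card_eq_eight hcard (R.subgroupOf S) (by
      rw [Ne, subgroupOf_eq_bot, disjoint_iff, inf_eq_left.2 hRS]
      exact hR)
    rw [← map_subtype_commutator]
    exact map_le_iff_le_comap.2 hle
  have hinf : S ⊓ commutator G = ⁅S, S⁆ := by
    refine le_antisymm ?_ (le_inf (commutator_le_self _) (commutator_mono le_top le_top))
    have := commutator_inf_eq_focalSubgroup (hS.toSylow hindex)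
    rw [IsPGroup.toSylow_coe] at this
    rw [inf_comm, this]
    exact focalSubgroup_le_commutator_of_conj fun u hu g hg =>
      exists_mem_conj_eq_of_card_eq_eight hcard hindex hN hu hg
  have hne : S ⊓ commutator G ≠ ⊥ := by
    rw [hinf, Ne, commutator_eq_bot_iff_le_centralizer]
    exact fun hle => hcomm ⟨⟨fun a b => Subtype.ext (hle b.2 a a.2)⟩⟩
  have := hS.isSolvable
  have hlt : S ⊓ commutator G < S := by
    have : Nontrivial S := Finite.one_lt_card_iff_nontrivial.1 (by simp [hcard])
    refine lt_of_le_of_ne inf_le_left fun he => ?_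
    refine (Group.IsSolvable.commutator_lt_top_of_nontrivial (G := S)).ne ?_
    rw [← map_subtype_inj, map_subtype_commutator, ← hinf, he, ← MonoidHom.range_eq_map,
      range_subtype]
  have hfour : Nat.card ↥(S ⊓ commutator G) ∣ 4 := by
    have h₁ : Nat.card ↥(S ⊓ commutator G) < Nat.card S := Set.ncard_lt_ncard hlt
    obtain ⟨k, hk, hk'⟩ := (Nat.dvd_prime_pow Nat.prime_two).1
      (show Nat.card ↥(S ⊓ commutator G) ∣ 2 ^ 3 from (card_dvd_of_le hlt.le).trans hcard.dvd)
    rw [hk', hcard] at h₁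
    rw [hk']
    interval_cases k <;> omega
  have hle : commutator G ≤ S := by
    refine le_of_solubilizer_subset_of_isMulCommutative hS h _ ?_
      (isMulCommutative_of_card_dvd_four hfour)
    refine inf_le_left.trans (hN _ inf_le_left hne ?_)
    rw [← normal_subgroupOf_iff_le_normalizer inf_le_left, inf_subgroupOf_left]
    infer_instance
  have := Subgroup.Normal.of_commutator_le G hle
  have hnorm := normalizer_le_of_solubilizer_subset h
  rwa [normalizer_eq_top, top_le_iff] at hnorm

end OrderEight

theorem stmt_12 {G : Type*} [Group G] [Finite G] (hG : ¬ IsSolvable G)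
    (x : G) (Q : Subgroup G) (hQ : (Q : Set G) = solubilizer x)
    (h2 : ∃ n : ℕ, Nat.card Q = 2 ^ n) :
    (¬ ∀ a b : Q, a * b = b * a) ∧ 16 ≤ Nat.card Q := by
  obtain ⟨n, hn⟩ := h2
  have hP : IsPGroup 2 Q := IsPGroup.of_card hn
  have htop : Q ≠ ⊤ := by
    rintro rfl
    have := hP.isSolvable
    exact hG (Group.isSolvable_of_surjective (f := (topEquiv (G := G)).toMonoidHom)
      topEquiv.surjective)
  have hcomm : ¬ IsMulCommutative Q := fun hc =>
    htop (eq_top_of_solubilizer_subset_of_isMulCommutative hP hQ.ge hc)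
  refine ⟨fun hc => hcomm ⟨⟨hc⟩⟩, ?_⟩
  have hfour : ¬ Nat.card Q ∣ 4 := fun hd => hcomm (isMulCommutative_of_card_dvd_four hd)
  have h_eight : Nat.card Q ≠ 8 := fun hc =>
    htop (eq_top_of_solubilizer_subset_of_card_eq_eight hc hQ.ge)
  rw [hn] at hfour h_eight ⊢
  by_contra! hlt
  have : n < 4 := (Nat.pow_lt_pow_iff_right one_lt_two).1 (show 2 ^ n < 2 ^ 4 from hlt)
  interval_cases n <;> omega
end

section
/- Let G be a finite insoluble group such that for some x ∈ G the set Sol_G(x) is the underlying set of a 2-subgroup of G. Suppose further that the quotient G/R(G) is isomorphic to a direct product of ℓ copies of PSL(2,p) for a prime p and some ℓ ≥ 1. Then p ≥ 31 and p is a Mersenne prime (p = 2^n − 1 for some n), the order of x is at least 8, and Sol_G(x)/R(G) is isomorphic to the direct product of ℓ copies of the dihedral group of order p + 1. -/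
open scoped MatrixGroups

/-- The soluble radical of a group: the join of all soluble normal subgroups.
For a finite group this is the largest soluble normal subgroup. -/
def solubleRadical (G : Type*) [Group G] : Subgroup G :=
  sSup {N : Subgroup G | N.Normal ∧ IsSolvable ↥N}

instance solubleRadical_normal (G : Type*) [Group G] : (solubleRadical G).Normal := by
  constructor
  intro n hn g
  rw [solubleRadical, sSup_eq_iSup'] at hn ⊢
  refine Subgroup.iSup_induction _ (C := fun m =>
    g * m * g⁻¹ ∈ ⨆ N : {N : Subgroup G // N ∈ {N : Subgroup G | N.Normal ∧ IsSolvable ↥N}},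
      (N : Subgroup G)) hn ?_ ?_ ?_
  · rintro ⟨N, hN⟩ x hx
    exact Subgroup.mem_iSup_of_mem ⟨N, hN⟩ (hN.1.conj_mem x hx g)
  · simpa using Subgroup.one_mem _
  · intro x y hx hy
    have : g * (x * y) * g⁻¹ = (g * x * g⁻¹) * (g * y * g⁻¹) := by group
    rw [this]
    exact Subgroup.mul_mem _ hx hy

theorem isSolvable_of_le {G : Type*} [Group G] {H K : Subgroup G} (h : H ≤ K)
    (hK : Group.IsSolvable K) : Group.IsSolvable H :=
  Group.isSolvable_of_isSolvable_injective (Subgroup.inclusion_injective h)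

theorem isSolvable_sup_zpowers {G : Type*} [Group G] [Finite G] (K : Subgroup G)
    (hK : Group.IsSolvable K) (g : G) (hg : ∀ k ∈ K, g * k * g⁻¹ ∈ K) :
    Group.IsSolvable ↥(K ⊔ Subgroup.zpowers g) := by
  have hgn : g ∈ Subgroup.normalizer (K : Set G) := by
    rw [Subgroup.mem_normalizer_iff_map_conj_eq]
    refine Subgroup.eq_of_le_of_card_ge ?_ ?_
    · rintro _ ⟨k, hk, rfl⟩
      exact hg k hk
    · exact (Subgroup.card_map_of_injective (MulAut.conj g).injective).ge
  set M := Subgroup.normalizer (K : Set G)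
  let q := QuotientGroup.mk' (K.subgroupOf M)
  let C := (Subgroup.zpowers (q ⟨g, hgn⟩)).comap q
  have hC : Group.IsSolvable C := by
    have hKs : Group.IsSolvable (K.subgroupOf M) :=
      Group.isSolvable_of_isSolvable_injective
        (f := (Subgroup.subgroupOfEquivOfLe (Subgroup.le_normalizer (H := K))).toMonoidHom)
        (Subgroup.subgroupOfEquivOfLe (Subgroup.le_normalizer (H := K))).injective
    have hZ : Group.IsSolvable (Subgroup.zpowers (q ⟨g, hgn⟩)) := inferInstance
    have hle : K.subgroupOf M ≤ C := by
      intro k hk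
      have : q k = 1 := (QuotientGroup.eq_one_iff k).2 hk
      rw [Subgroup.mem_comap, this]
      exact one_mem _
    refine Group.isSolvable_of_ker_le_range (Subgroup.inclusion hle)
      (q.subgroupComap (Subgroup.zpowers (q ⟨g, hgn⟩))) ?_
    intro y hy
    have hy' : q y.1 = 1 := congrArg Subtype.val hy
    exact ⟨⟨y.1, (QuotientGroup.eq_one_iff y.1).1 hy'⟩, rfl⟩
  have : K ⊔ Subgroup.zpowers g ≤ C.map M.subtype := by
    refine sup_le ?_ ?_
    · intro k hk
      refine ⟨⟨k, Subgroup.le_normalizer hk⟩, ?_, rfl⟩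
      have : q ⟨k, Subgroup.le_normalizer hk⟩ = 1 :=
        (QuotientGroup.eq_one_iff (⟨k, Subgroup.le_normalizer hk⟩ : M)).2 hk
      rw [SetLike.mem_coe, Subgroup.mem_comap, this]
      exact one_mem _
    · rw [Subgroup.zpowers_le]
      exact ⟨⟨g, hgn⟩, Subgroup.mem_zpowers _, rfl⟩
  refine isSolvable_of_le this ?_
  exact Group.isSolvable_of_surjective (M.subtype.subgroupMap_surjective C)

theorem mem_solubilizer_of_conj_mem {G : Type*} [Group G] [Finite G] (K : Subgroup G)
    (hK : Group.IsSolvable K) {x y : G} (hx : ∀ k ∈ K, x * k * x⁻¹ ∈ K) (hy : y ∈ K) :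
    y ∈ solubilizer x := by
  refine isSolvable_of_le ?_ (isSolvable_sup_zpowers K hK x hx)
  rw [Subgroup.closure_le]
  rintro z (rfl | rfl)
  · exact Subgroup.mem_sup_right (Subgroup.mem_zpowers _)
  · exact Subgroup.mem_sup_left hy

/-- The relations of the octahedral group. -/
theorem mem_solubilizer_of_octahedral {G : Type*} [Group G] [Finite G] {x y : G}
    (hx : x ^ 4 = 1) (hy : y ^ 3 = 1) (hxy : (x * y) ^ 2 = 1) : y ∈ solubilizer x := by
  simp only [pow_succ, pow_zero, one_mul] at hx hy hxy
  obtain ⟨a, ha⟩ : ∃ a, a = x * x := ⟨_, rfl⟩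
  obtain ⟨b, hb⟩ : ∃ b, b = y * a * y⁻¹ := ⟨_, rfl⟩
  have haa : a * a = 1 := by rw [ha, ← hx]; group
  have hxyx : x * y * x = y⁻¹ := by
    rw [eq_inv_iff_mul_eq_one, ← hxy]; group
  have h1 : y * a * y * a * y = a := by
    have e1 : x * (y * a * y * a * y) * x = y⁻¹ * y⁻¹ * y⁻¹ := by
      rw [← hxyx, ha]; group
    have e2 : y⁻¹ * y⁻¹ * y⁻¹ = 1 := by
      have : y⁻¹ * y⁻¹ * y⁻¹ = (y * y * y)⁻¹ := by group
      rw [this, hy, inv_one]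
    have e3 : y * a * y * a * y = x⁻¹ * x⁻¹ := by
      have := e1.trans e2
      have h : y * a * y * a * y = x⁻¹ * (x * (y * a * y * a * y) * x) * x⁻¹ := by group
      rw [h, this]; group
    rw [e3, ha]
    have : x⁻¹ * x⁻¹ = (x * x * x * x)⁻¹ * (x * x) := by group
    rw [this, hx]; group
  obtain ⟨c, hc⟩ : ∃ c, c = y * b * y⁻¹ := ⟨_, rfl⟩
  have hbc : b * c = a := by
    have : b * c = (y * a * y * a * y) * (y * y * y)⁻¹ := by rw [hc, hb]; group
    rw [this, h1, hy]; group
  have hca : y * c * y⁻¹ = a := by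
    have : y * c * y⁻¹ = (y * y * y) * a * (y * y * y)⁻¹ := by rw [hc, hb]; group
    rw [this, hy]; group
  have hcab : c * a = b := by
    have := congrArg (fun z => y * z * y⁻¹) hbc
    simp only [← hb] at this
    rw [← this]
    have : y * (b * c) * y⁻¹ = (y * b * y⁻¹) * (y * c * y⁻¹) := by group
    rw [this, ← hc, hca]
  have hceq : c = b * a := by rw [← hcab]; rw [mul_assoc, haa, mul_one]
  have hba : b * a = a * b := by
    have h : y * (c * a) * y⁻¹ = (y * c * y⁻¹) * (y * a * y⁻¹) := by group
    rw [hcab, hca, ← hb, ← hc] at h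
    rw [← hceq, h]
  let V := Subgroup.closure ({a, b} : Set G)
  have haV : a ∈ V := Subgroup.subset_closure (by simp)
  have hbV : b ∈ V := Subgroup.subset_closure (by simp)
  have hV : Group.IsSolvable V := by
    have : IsMulCommutative V := by
      refine Subgroup.isMulCommutative_closure ?_
      rintro u (rfl | rfl) v (rfl | rfl) <;> first | rfl | exact hba | exact hba.symm
    exact Group.isSolvable_of_comm fun u v => mul_comm' u v
  have conjV : ∀ g : G, g * a * g⁻¹ ∈ V → g * b * g⁻¹ ∈ V → ∀ k ∈ V, g * k * g⁻¹ ∈ V := by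
    intro g h1 h2 k hk
    have : V ≤ V.comap (MulAut.conj g).toMonoidHom := by
      rw [Subgroup.closure_le]
      rintro z (rfl | rfl)
      · exact h1
      · exact h2
    exact this hk
  have hW := isSolvable_sup_zpowers V hV y (conjV y (hb ▸ hbV) (by
    rw [← hc, hceq]; exact mul_mem hbV haV))
  refine mem_solubilizer_of_conj_mem _ hW ?_ (Subgroup.mem_sup_right (Subgroup.mem_zpowers y))
  have hyW : y ∈ V ⊔ Subgroup.zpowers y := Subgroup.mem_sup_right (Subgroup.mem_zpowers y)
  have haW : a ∈ V ⊔ Subgroup.zpowers y := Subgroup.mem_sup_left haV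
  have hbW : b ∈ V ⊔ Subgroup.zpowers y := Subgroup.mem_sup_left hbV
  have hxa : x * a * x⁻¹ = a := by rw [ha]; group
  have hxy' : x * y * x⁻¹ = y⁻¹ * a⁻¹ := by
    rw [← hxyx, ha]; group
  intro k hk
  have : V ⊔ Subgroup.zpowers y ≤
      (V ⊔ Subgroup.zpowers y).comap (MulAut.conj x).toMonoidHom := by
    refine sup_le ?_ ?_
    · rw [Subgroup.closure_le]
      rintro z (rfl | rfl)
      · change x * z * x⁻¹ ∈ V ⊔ Subgroup.zpowers y
        rw [hxa]; exact haW
      · change x * z * x⁻¹ ∈ V ⊔ Subgroup.zpowers y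
        have : x * z * x⁻¹ = (x * y * x⁻¹) * (x * a * x⁻¹) * (x * y * x⁻¹)⁻¹ := by
          rw [hb]; group
        rw [this, hxa, hxy']
        exact mul_mem (mul_mem (mul_mem (inv_mem hyW) (inv_mem haW)) haW)
          (inv_mem (mul_mem (inv_mem hyW) (inv_mem haW)))
    · rw [Subgroup.zpowers_le]
      change x * y * x⁻¹ ∈ V ⊔ Subgroup.zpowers y
      rw [hxy']
      exact mul_mem (inv_mem hyW) (inv_mem haW)
  exact this hk

theorem map_mem_solubilizer {G H : Type*} [Group G] [Group H] (f : G →* H) {x y : G}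
    (h : y ∈ solubilizer x) : f y ∈ solubilizer (f x) := by
  have h' : Group.IsSolvable (Subgroup.closure ({x, y} : Set G)) := h
  have := Group.isSolvable_of_surjective (f.subgroupMap_surjective (Subgroup.closure {x, y}))
  rw [MonoidHom.map_closure, Set.image_pair] at this
  exact this

/-- The transvection of the plane along the vector `(v₀, v₁)` with parameter `s`. -/
def transvectionAlong {F : Type*} [Field F] (v₀ v₁ s : F) : SL(2, F) :=
  ⟨!![1 - s * v₀ * v₁, s * v₀ ^ 2; -(s * v₁ ^ 2), 1 + s * v₀ * v₁], by
    rw [Matrix.det_fin_two_of]; ring⟩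

theorem coe_transvectionAlong {F : Type*} [Field F] (v₀ v₁ s : F) :
    (transvectionAlong v₀ v₁ s : Matrix (Fin 2) (Fin 2) F) =
      !![1 - s * v₀ * v₁, s * v₀ ^ 2; -(s * v₁ ^ 2), 1 + s * v₀ * v₁] := rfl

/-- The one-parameter group of transvections of the plane along the vector `(v₀, v₁)`. -/
def transvectionHom {F : Type*} [Field F] (v₀ v₁ : F) : Multiplicative F →* SL(2, F) :=
  MonoidHom.mk' (fun s => transvectionAlong v₀ v₁ s.toAdd) fun s t => by
    ext i j
    rw [Matrix.SpecialLinearGroup.coe_mul, Matrix.mul_apply, Fin.sum_univ_two]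
    fin_cases i <;> fin_cases j <;> simp [coe_transvectionAlong] <;> ring

theorem coe_transvectionHom {F : Type*} [Field F] (v₀ v₁ : F) (s : Multiplicative F) :
    (transvectionHom v₀ v₁ s : Matrix (Fin 2) (Fin 2) F) =
      !![1 - s.toAdd * v₀ * v₁, s.toAdd * v₀ ^ 2; -(s.toAdd * v₁ ^ 2), 1 + s.toAdd * v₀ * v₁] :=
  rfl

theorem mul_transvectionHom {F : Type*} [Field F] (A : SL(2, F)) {v₀ v₁ r : F}
    (h₀ : A 0 0 * v₀ + A 0 1 * v₁ = r * v₀) (h₁ : A 1 0 * v₀ + A 1 1 * v₁ = r * v₁) (s : F) :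
    A * transvectionHom v₀ v₁ (.ofAdd s) = transvectionHom v₀ v₁ (.ofAdd (r ^ 2 * s)) * A := by
  have hdet := A.det_coe
  rw [Matrix.det_fin_two] at hdet
  have h2 : r * (A 0 0 * v₁ - A 1 0 * v₀) = v₁ := by
    linear_combination A 1 0 * h₀ - A 0 0 * h₁ + v₁ * hdet
  have h3 : r * (A 1 1 * v₀ - A 0 1 * v₁) = v₀ := by
    linear_combination A 0 1 * h₁ - A 1 1 * h₀ + v₀ * hdet
  ext i j
  rw [Matrix.SpecialLinearGroup.coe_mul, Matrix.SpecialLinearGroup.coe_mul, Matrix.mul_apply,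
    Matrix.mul_apply, Fin.sum_univ_two, Fin.sum_univ_two, coe_transvectionHom,
    coe_transvectionHom]
  fin_cases i <;> fin_cases j <;> simp <;> grind

theorem mem_center_two {F : Type*} [Field F] {A : SL(2, F)} :
    A ∈ Subgroup.center SL(2, F) ↔ A = 1 ∨ A = -1 := by
  rw [Matrix.SpecialLinearGroup.mem_center_iff]
  constructor
  · rintro ⟨r, hr, hA⟩
    simp only [Fintype.card_fin, sq_eq_one_iff] at hr
    rcases hr with rfl | rfl
    · left; ext i j; rw [← hA]; simp
    · right
      ext i j
      rw [← hA, map_neg]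
      simp
  · rintro (rfl | rfl)
    · exact ⟨1, by simp, by simp⟩
    · exact ⟨-1, by simp, by rw [Matrix.SpecialLinearGroup.coe_neg, map_neg]; simp⟩

theorem sq_sub_trace_mul_add_one_ne_zero {p : ℕ} [Fact p.Prime] (hp : p ≠ 2) (A : SL(2, ZMod p))
    (hA : ∀ B ∈ solubilizer A, ∃ n : ℕ, B ^ 2 ^ n = 1) (r : ZMod p) :
    r ^ 2 - (A 0 0 + A 1 1) * r + 1 ≠ 0 := by
  intro hr
  have hdet := A.det_coe
  rw [Matrix.det_fin_two] at hdet
  have h0 : (A.1 - r • (1 : Matrix (Fin 2) (Fin 2) (ZMod p))).det = 0 := by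
    rw [Matrix.det_fin_two]
    simp
    linear_combination hr + hdet
  obtain ⟨v, hv, hAv⟩ := Matrix.exists_mulVec_eq_zero_iff.2 h0
  have e0 := congrFun hAv 0
  have e1 := congrFun hAv 1
  simp [Matrix.mulVec, dotProduct, Fin.sum_univ_two] at e0 e1
  have hr0 : r ≠ 0 := by rintro rfl; simp at hr
  set K := (transvectionHom (v 0) (v 1)).range
  have hKs : Group.IsSolvable K :=
    Group.isSolvable_of_surjective (transvectionHom (v 0) (v 1)).rangeRestrict_surjective
  have hconj : ∀ k ∈ K, A * k * A⁻¹ ∈ K := by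
    rintro _ ⟨s, rfl⟩
    refine ⟨.ofAdd (r ^ 2 * s.toAdd), ?_⟩
    rw [eq_mul_inv_iff_mul_eq]
    exact (mul_transvectionHom A (by linear_combination e0) (by linear_combination e1) _).symm
  obtain ⟨n, hn⟩ := hA _ (mem_solubilizer_of_conj_mem K hKs hconj ⟨.ofAdd 1, rfl⟩)
  rw [← map_pow] at hn
  have h2 : (2 : ZMod p) ≠ 0 := by
    have := ZMod.prime_ne_zero p 2 hp
    exact_mod_cast this
  have e2 := congrArg (fun B : SL(2, ZMod p) => B 0 1) hn
  have e3 := congrArg (fun B : SL(2, ZMod p) => B 1 0) hn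
  simp only [coe_transvectionHom] at e2 e3
  simp [h2] at e2 e3
  exact hv (by ext i; fin_cases i <;> simp [e2, e3])

open Polynomial in
/-- An element of `SL(2, p)` without eigenvalues in the prime field generates a copy of the field
with `p ^ 2` elements, whose elements of norm one lie in `SL(2, p)`. -/
theorem exists_aeval_eq_zero_iff_of_no_eigenvalue {p : ℕ} [Fact p.Prime]
    {K : Type*} [Field K] [Algebra (ZMod p) K] [IsAlgClosed K] (A : SL(2, ZMod p))
    (hA : ∀ r : ZMod p, r ^ 2 - (A 0 0 + A 1 1) * r + 1 ≠ 0)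
    (ζ : K) (hζ : ζ ^ (p + 1) = 1) :
    ∃ (B : SL(2, ZMod p)) (a b : ZMod p),
      B.1 = a • (1 : Matrix (Fin 2) (Fin 2) (ZMod p)) + b • A.1 ∧
      ∀ f : (ZMod p)[X], aeval B.1 f = 0 ↔ aeval ζ f = 0 := by
  have : CharP K p := charP_of_injective_algebraMap (algebraMap (ZMod p) K).injective p
  have hdet := A.det_coe
  have hdet' := A.det_coe
  rw [Matrix.det_fin_two] at hdet'
  have htr : A.1.trace = A 0 0 + A 1 1 := Matrix.trace_fin_two _
  set t := A 0 0 + A 1 1 with ht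
  have hχ : A.1.charpoly = X ^ 2 - C t * X + 1 := by
    rw [Matrix.charpoly_fin_two, htr, hdet, C_1]
  have hmonic := A.1.charpoly_monic
  have hdeg : A.1.charpoly.natDegree = 2 := by
    rw [Matrix.charpoly_natDegree_eq_dim, Fintype.card_fin]
  have hirr : Irreducible A.1.charpoly := by
    refine irreducible_of_degree_le_three_of_not_isRoot (by simp [hdeg]) fun r hr => hA r ?_
    rw [IsRoot, hχ] at hr
    simpa using hr
  obtain ⟨l, hl⟩ := IsAlgClosed.exists_aeval_eq_zero K A.1.charpoly
    (degree_pos_of_irreducible hirr).ne'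
  have hminA : A.1.charpoly = minpoly (ZMod p) A.1 :=
    minpoly.eq_of_irreducible_of_monic hirr (Matrix.aeval_self_charpoly A.1) hmonic
  have hminl : A.1.charpoly = minpoly (ZMod p) l :=
    minpoly.eq_of_irreducible_of_monic hirr hl hmonic
  have hmin : ∀ f : (ZMod p)[X], aeval A.1 f = 0 ↔ aeval l f = 0 := by
    intro f
    rw [← minpoly.dvd_iff, ← minpoly.dvd_iff, ← hminl, ← hminA]
  have hmem : ∀ x : K, x ^ p = x →
      ∃ r : ZMod p, algebraMap (ZMod p) K r = x := by
    intro x hx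
    rw [← Subfield.mem_bot_iff_pow_eq_self, ← ZMod.fieldRange_castHom_eq_bot p] at hx
    obtain ⟨r, hr⟩ := hx
    exact ⟨r, hr ▸ RingHom.congr_fun
      (Subsingleton.elim (algebraMap (ZMod p) K) (ZMod.castHom dvd_rfl K)) r⟩
  have hl1 : l ^ 2 - algebraMap _ _ t * l + 1 = 0 := by
    rw [hχ] at hl
    simpa using hl
  obtain ⟨m, hm⟩ : ∃ m, m = l ^ p := ⟨_, rfl⟩
  have hm1 : m ^ 2 - algebraMap _ _ t * m + 1 = 0 := by
    have := congrArg (fun z => z ^ p) hl1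
    simp only [add_pow_char, sub_pow_char, mul_pow, one_pow] at this
    rw [← map_pow, ZMod.pow_card, zero_pow (Fact.out : p.Prime).ne_zero] at this
    rw [hm, ← this]
    ring
  have hlm : l - m ≠ 0 := by
    intro h
    obtain ⟨r, hr⟩ := hmem l (by rw [← hm]; exact (sub_eq_zero.1 h).symm)
    apply hA r
    apply (algebraMap (ZMod p) K).injective
    simpa [hr] using hl1
  have hsum : l + m = algebraMap _ _ t := by
    apply mul_left_cancel₀ hlm
    linear_combination hl1 - hm1
  have hprod : l * m = 1 := by linear_combination l * hsum - hl1
  have hmp : m ^ p = l := by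
    have h1 : m * m ^ p = 1 := by rw [hm, ← mul_pow, ← hm, hprod, one_pow]
    have hm0 : m ≠ 0 := right_ne_zero_of_mul (hprod ▸ one_ne_zero)
    apply mul_left_cancel₀ hm0
    rw [h1, mul_comm, hprod]
  obtain ⟨z, hz⟩ : ∃ z, z = ζ ^ p := ⟨_, rfl⟩
  have hz1 : ζ * z = 1 := by rw [hz, ← pow_succ', hζ]
  have hzp : z ^ p = ζ := by
    have h1 : z * z ^ p = 1 := by rw [hz, ← mul_pow, ← hz, hz1, one_pow]
    have hz0 : z ≠ 0 := right_ne_zero_of_mul (hz1 ▸ one_ne_zero)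
    apply mul_left_cancel₀ hz0
    rw [h1, mul_comm, hz1]
  obtain ⟨b', hb'⟩ : ∃ b', b' = (ζ - z) / (l - m) := ⟨_, rfl⟩
  have hb1 : b' * (l - m) = ζ - z := by rw [hb']; field_simp
  have hbp : b' ^ p = b' := by
    apply mul_right_cancel₀ hlm
    have := congrArg (fun z => z ^ p) hb1
    simp only [sub_pow_char, mul_pow, ← hm, ← hz, hmp, hzp] at this
    linear_combination -this - hb1
  obtain ⟨a', ha'⟩ : ∃ a', a' = ζ - b' * l := ⟨_, rfl⟩
  have hap : a' ^ p = a' := by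
    rw [ha']
    simp only [sub_pow_char, mul_pow, ← hm, ← hz, hbp]
    linear_combination hb1
  obtain ⟨b, hb⟩ := hmem b' hbp
  obtain ⟨a, ha⟩ := hmem a' hap
  have hnorm : a ^ 2 + a * b * t + b ^ 2 = 1 := by
    apply (algebraMap (ZMod p) K).injective
    simp only [map_add, map_mul, map_pow, map_one, ha, hb, ← hsum]
    have h2 : a' + b' * m = z := by rw [ha']; linear_combination -hb1
    have h1 : a' + b' * l = ζ := by rw [ha']; ring
    rw [← hz1, ← h1, ← h2]
    linear_combination -(b' ^ 2) * hprod
  refine ⟨⟨a • (1 : Matrix (Fin 2) (Fin 2) (ZMod p)) + b • A.1, ?_⟩, a, b, rfl, fun f => ?_⟩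
  · rw [Matrix.det_fin_two]
    simp
    linear_combination hnorm + b ^ 2 * hdet'
  · have h := hmin (f.comp (C a + C b * X))
    rw [aeval_comp, aeval_comp] at h
    have e1 : aeval A.1 (C a + C b * X) = a • (1 : Matrix (Fin 2) (Fin 2) (ZMod p)) + b • A.1 := by
      simp [Algebra.algebraMap_eq_smul_one]
    have e2 : aeval l (C a + C b * X) = ζ := by
      simp [ha, hb, ha']
    rw [e1, e2] at h
    exact h

theorem exists_pow_eq_one_of_mk {F : Type*} [Field F] {A : SL(2, F)}
    (hA : ∀ y ∈ solubilizer (QuotientGroup.mk' (Subgroup.center SL(2, F)) A),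
      ∃ n : ℕ, y ^ 2 ^ n = 1) :
    ∀ B ∈ solubilizer A, ∃ n : ℕ, B ^ 2 ^ n = 1 := by
  intro B hB
  obtain ⟨n, hn⟩ := hA _ (map_mem_solubilizer (QuotientGroup.mk' (Subgroup.center SL(2, F))) hB)
  refine ⟨n + 1, ?_⟩
  rw [← map_pow, QuotientGroup.mk'_apply, QuotientGroup.eq_one_iff, mem_center_two] at hn
  rw [pow_succ, pow_mul]
  rcases hn with h | h <;> simp [h]

open Polynomial in
theorem exists_add_one_eq_two_pow {p : ℕ} [Fact p.Prime] (hp : p ≠ 2) (A : SL(2, ZMod p))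
    (hA : ∀ B ∈ solubilizer A, ∃ n : ℕ, B ^ 2 ^ n = 1) : ∃ n : ℕ, p + 1 = 2 ^ n := by
  rcases Nat.eq_two_pow_or_exists_odd_prime_and_dvd (p + 1) with h | ⟨q, hq, hqp, hodd⟩
  · exact h
  exfalso
  have : NeZero (q : AlgebraicClosure (ZMod p)) := by
    refine ⟨fun h => ?_⟩
    have := charP_of_injective_algebraMap
      (algebraMap (ZMod p) (AlgebraicClosure (ZMod p))).injective p
    rw [CharP.cast_eq_zero_iff _ p, Nat.prime_dvd_prime_iff_eq Fact.out hq] at h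
    subst h
    have := (Nat.dvd_add_right dvd_rfl).1 hqp
    exact hq.one_lt.ne' (Nat.dvd_one.1 this)
  obtain ⟨ζ, hζ⟩ := HasEnoughRootsOfUnity.exists_primitiveRoot (AlgebraicClosure (ZMod p)) q
  obtain ⟨B, a, b, hB, hBζ⟩ := exists_aeval_eq_zero_iff_of_no_eigenvalue A
    (sq_sub_trace_mul_add_one_ne_zero hp A hA) ζ ((hζ.pow_eq_one_iff_dvd _).2 hqp)
  have hcomm : Commute A B := by
    apply Subtype.ext
    change A.1 * B.1 = B.1 * A.1
    rw [hB]
    simp [mul_add, add_mul]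
  obtain ⟨k, hk⟩ := hA B (mem_solubilizer_of_conj_mem (Subgroup.zpowers B) inferInstance
    (fun z hz => by
      obtain ⟨i, rfl⟩ := hz
      have : A * B ^ i * A⁻¹ = B ^ i := by rw [(hcomm.zpow_right i).eq, mul_inv_cancel_right]
      simp only [this]
      exact ⟨i, rfl⟩) (Subgroup.mem_zpowers B))
  have h1 : aeval ζ (X ^ 2 ^ k - 1 : (ZMod p)[X]) = 0 := by
    rw [← hBζ]
    have := congrArg Subtype.val hk
    simpa [sub_eq_zero] using this
  simp only [map_sub, map_pow, aeval_X, map_one, sub_eq_zero] at h1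
  rw [hζ.pow_eq_one_iff_dvd] at h1
  have := hq.dvd_of_dvd_pow h1
  rw [Nat.prime_dvd_prime_iff_eq hq Nat.prime_two] at this
  subst this
  exact absurd hodd (by decide)

/-- The homomorphism from a dihedral group given by its presentation. -/
def dihedralLift {G : Type*} [Group G] {m : ℕ} (ρ : ZMod m →+ Additive G) (w : G)
    (hw : w * w = 1) (hρ : ∀ i, w * (ρ i).toMul * w = (ρ (-i)).toMul) : DihedralGroup m →* G :=
  MonoidHom.mk' (fun g => match g with
    | .r i => (ρ i).toMul
    | .sr i => w * (ρ i).toMul) <| by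
    have h1 : ∀ i, (ρ i).toMul * w = w * (ρ (-i)).toMul := fun i => by
      rw [← hρ, ← mul_assoc, ← mul_assoc, hw, one_mul]
    rintro (i | i) (j | j)
    · simp
    · simp only [DihedralGroup.r_mul_sr]
      rw [← mul_assoc, h1, mul_assoc, ← toMul_add, ← map_add, neg_add_eq_sub]
    · simp [mul_assoc]
    · simp only [DihedralGroup.sr_mul_sr]
      rw [← mul_assoc, hρ, ← toMul_add, ← map_add, neg_add_eq_sub]

theorem dihedralLift_injective {G : Type*} [Group G] {m : ℕ} (ρ : ZMod m →+ Additive G) (w : G)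
    (hw : w * w = 1) (hρ : ∀ i, w * (ρ i).toMul * w = (ρ (-i)).toMul)
    (hinj : Function.Injective ρ) (hne : ∀ i, w ≠ (ρ i).toMul) :
    Function.Injective (dihedralLift ρ w hw hρ) := by
  rw [injective_iff_map_eq_one]
  rintro (i | i) h
  · change (ρ i).toMul = 1 at h
    rw [toMul_eq_one, map_eq_zero_iff ρ hinj] at h
    rw [h, DihedralGroup.r_zero]
  · change w * (ρ i).toMul = 1 at h
    refine absurd ?_ (hne (-i))
    rw [map_neg, toMul_neg]
    exact eq_inv_of_mul_eq_one_left h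

/-- A group containing elements inverted as in a dihedral group contains a dihedral group. -/
theorem exists_injective_dihedralGroup {G : Type*} [Group G] {m : ℕ} (hm : 2 < m) (r w : G)
    (hr : orderOf r = m) (hw : w * w = 1) (hrw : w * r * w = r⁻¹) :
    ∃ f : DihedralGroup m →* G, Function.Injective f := by
  have hwi : w⁻¹ = w := inv_eq_of_mul_eq_one_left hw
  have hr' : zmultiplesHom (Additive G) (.ofMul r) m = 0 := by
    rw [zmultiplesHom_apply, natCast_zsmul, ← ofMul_pow, ← hr, pow_orderOf_eq_one]; rfl
  let ρ : ZMod m →+ Additive G := ZMod.lift m ⟨zmultiplesHom (Additive G) (.ofMul r), hr'⟩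
  have hρ : ∀ k : ℤ, (ρ k).toMul = r ^ k := fun k => by
    simp [ρ]
  have hconj : ∀ k : ℤ, w * r ^ k * w = r ^ (-k) := fun k => by
    have := conj_zpow (i := k) (a := w) (b := r)
    rw [hwi, hrw, inv_zpow'] at this
    exact this.symm
  refine ⟨dihedralLift ρ w hw fun i => ?_, dihedralLift_injective ρ w hw _ ?_ fun i h => ?_⟩
  · obtain ⟨k, rfl⟩ := ZMod.intCast_surjective i
    rw [← Int.cast_neg, hρ, hρ, hconj]
  · rw [injective_iff_map_eq_zero]
    intro i hi
    obtain ⟨k, rfl⟩ := ZMod.intCast_surjective i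
    rw [← toMul_eq_one, hρ, ← orderOf_dvd_iff_zpow_eq_one, hr] at hi
    exact (ZMod.intCast_zmod_eq_zero_iff_dvd _ _).2 hi
  · obtain ⟨k, rfl⟩ := ZMod.intCast_surjective i
    rw [hρ] at h
    have h1 : w * r * w = r := by
      have : w * r = r * w := by
        rw [h]
        exact (Commute.refl r).zpow_left k
      rw [this, mul_assoc, hw, mul_one]
    rw [h1] at hrw
    have : r ^ 2 = 1 := by rw [sq, ← eq_inv_iff_mul_eq_one]; exact hrw
    have := Nat.le_of_dvd two_pos (orderOf_dvd_of_pow_eq_one this)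
    omega

theorem card_specialLinearGroup_two (p : ℕ) [Fact p.Prime] :
    Nat.card SL(2, ZMod p) = p * (p - 1) * (p + 1) := by
  have h1 := Matrix.card_GL_field (𝔽 := ZMod p) 2
  have hsurj : Function.Surjective (Matrix.GeneralLinearGroup.det (n := Fin 2) (R := ZMod p)) := by
    intro u
    refine ⟨Matrix.GeneralLinearGroup.mkOfDetNeZero (Matrix.diagonal ![(u : ZMod p), 1]) ?_, ?_⟩
    · simp
    · ext; simp [Matrix.GeneralLinearGroup.mkOfDetNeZero]
  have h2 := Subgroup.card_mul_index
    (Matrix.GeneralLinearGroup.det (n := Fin 2) (R := ZMod p)).ker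
  have h3 : Nat.card (Matrix.GeneralLinearGroup.det (n := Fin 2) (R := ZMod p)).ker =
      Nat.card SL(2, ZMod p) := by
    have e : (Matrix.GeneralLinearGroup.det (n := Fin 2) (R := ZMod p)).ker =
        (Matrix.SpecialLinearGroup.toGL (n := Fin 2) (R := ZMod p)).range := by
      ext g
      rw [MonoidHom.mem_ker, MonoidHom.mem_range]
      constructor
      · intro h
        exact ⟨⟨g, congrArg Units.val h⟩, by ext; rfl⟩
      · rintro ⟨A, rfl⟩
        ext
        simp
    rw [e]
    refine (Nat.card_congr (MonoidHom.ofInjective ?_).toEquiv).symm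
    intro A B h
    exact Subtype.ext (congrArg Units.val h)
  rw [Subgroup.index_ker, h3, MonoidHom.range_eq_top.2 hsurj, Subgroup.card_top,
    Nat.card_eq_fintype_card (α := (ZMod p)ˣ), ZMod.card_units, h1, Fin.prod_univ_two,
    ZMod.card] at h2
  have hp := (Fact.out : p.Prime).two_le
  obtain ⟨q, rfl⟩ := Nat.exists_eq_add_of_le hp
  apply Nat.eq_of_mul_eq_mul_right (show 0 < 2 + q - 1 by omega)
  rw [h2]
  have e1 : (2 + q) ^ 2 - (2 + q) ^ (0 : Fin 2).val = (q + 3) * (q + 1) := by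
    simp
    rw [Nat.sub_eq_iff_eq_add (Nat.one_le_pow _ _ (by omega))]
    ring
  have e2 : (2 + q) ^ 2 - (2 + q) ^ (1 : Fin 2).val = (q + 2) * (q + 1) := by
    simp
    rw [Nat.sub_eq_iff_eq_add (by nlinarith)]
    ring
  rw [e1, e2, show 2 + q - 1 = q + 1 by omega]
  ring

theorem card_projectiveSpecialLinearGroup_two (p : ℕ) [Fact p.Prime] (hp : p ≠ 2) :
    Nat.card PSL(2, ZMod p) * 2 = p * (p - 1) * (p + 1) := by
  have h2 : (2 : ZMod p) ≠ 0 := by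
    have := ZMod.prime_ne_zero p 2 hp
    exact_mod_cast this
  rw [← card_specialLinearGroup_two,
    (Subgroup.center SL(2, ZMod p)).card_eq_card_quotient_mul_card_subgroup]
  congr 1
  have : ((Subgroup.center SL(2, ZMod p) : Set SL(2, ZMod p))) = {1, -1} := by
    ext A
    exact mem_center_two
  change 2 = Nat.card (Subgroup.center SL(2, ZMod p) : Set SL(2, ZMod p))
  rw [this, Nat.card_coe_set_eq, Set.ncard_pair]
  intro h
  have := congrArg (fun B : SL(2, ZMod p) => B 0 0) h
  simp at this
  apply h2
  linear_combination this

theorem mk_eq_one_iff {F : Type*} [Field F] {A : SL(2, F)} :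
    QuotientGroup.mk' (Subgroup.center SL(2, F)) A = 1 ↔ A = 1 ∨ A = -1 := by
  rw [QuotientGroup.mk'_apply, QuotientGroup.eq_one_iff, mem_center_two]

open Polynomial in
theorem exists_injective_dihedralGroup_psl {p : ℕ} [Fact p.Prime] (hp : 5 ≤ p) (h4 : p % 4 = 3) :
    ∃ f : DihedralGroup ((p + 1) / 2) →* PSL(2, ZMod p), Function.Injective f := by
  let J : SL(2, ZMod p) := ⟨!![0, 1; -1, 0], by simp⟩
  have hJ : ∀ r : ZMod p, r ^ 2 - (J 0 0 + J 1 1) * r + 1 ≠ 0 := by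
    intro r hr
    have hr' : IsSquare (-1 : ZMod p) := ⟨r, by simp [J] at hr; linear_combination -hr⟩
    exact ZMod.exists_sq_eq_neg_one_iff.1 hr' h4
  have : CharP (AlgebraicClosure (ZMod p)) p := charP_of_injective_algebraMap
      (algebraMap (ZMod p) (AlgebraicClosure (ZMod p))).injective p
  have : NeZero ((p + 1 : ℕ) : AlgebraicClosure (ZMod p)) := ⟨by simp⟩
  obtain ⟨ζ, hζ⟩ := HasEnoughRootsOfUnity.exists_primitiveRoot (AlgebraicClosure (ZMod p)) (p + 1)
  obtain ⟨R, a, b, hR, hRζ⟩ := exists_aeval_eq_zero_iff_of_no_eigenvalue J hJ ζ hζ.pow_eq_one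
  have hR' : R.1 = !![a, b; -b, a] := by
    rw [hR]
    ext i j
    fin_cases i <;> fin_cases j <;> simp [J]
  obtain ⟨m, hm⟩ : ∃ m, p + 1 = 2 * m := ⟨(p + 1) / 2, by omega⟩
  have hm' : (p + 1) / 2 = m := by omega
  rw [hm']
  have hpow : R ^ m = -1 := by
    have h1 : aeval ζ (X ^ m + 1 : (ZMod p)[X]) = 0 := by
      have h2 : (ζ ^ m) ^ 2 = 1 := by rw [← pow_mul, mul_comm, ← hm, hζ.pow_eq_one]
      rcases sq_eq_one_iff.1 h2 with h | h
      · rw [hζ.pow_eq_one_iff_dvd] at h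
        have := Nat.le_of_dvd (by omega) h
        omega
      · simp [h]
    rw [← hRζ] at h1
    apply Subtype.ext
    simp only [map_add, map_pow, aeval_X, map_one] at h1
    simpa using eq_neg_of_add_eq_zero_left h1
  have hord : orderOf (QuotientGroup.mk' (Subgroup.center SL(2, ZMod p)) R) = m := by
    apply Nat.dvd_antisymm
    · apply orderOf_dvd_of_pow_eq_one
      rw [← map_pow, mk_eq_one_iff]
      exact Or.inr hpow
    · have h1 := pow_orderOf_eq_one (QuotientGroup.mk' (Subgroup.center SL(2, ZMod p)) R)
      set k := orderOf (QuotientGroup.mk' (Subgroup.center SL(2, ZMod p)) R)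
      rw [← map_pow, mk_eq_one_iff] at h1
      have h2 : R ^ (2 * k) = 1 := by
        rw [mul_comm, pow_mul]
        rcases h1 with h | h <;> simp [h]
      have h3 : aeval ζ (X ^ (2 * k) - 1 : (ZMod p)[X]) = 0 := by
        rw [← hRζ]
        have := congrArg Subtype.val h2
        simpa [sub_eq_zero] using this
      simp only [map_sub, map_pow, aeval_X, map_one, sub_eq_zero] at h3
      rw [hζ.pow_eq_one_iff_dvd, hm] at h3
      exact Nat.dvd_of_mul_dvd_mul_left two_pos h3
  obtain ⟨c, d, hcd⟩ := ZMod.sq_add_sq p (-1)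
  obtain ⟨w, hw⟩ : ∃ w : SL(2, ZMod p), w.1 = !![c, d; d, -c] :=
    ⟨⟨!![c, d; d, -c], by rw [Matrix.det_fin_two_of]; linear_combination -hcd⟩, rfl⟩
  have hdet := R.det_coe
  rw [hR', Matrix.det_fin_two_of] at hdet
  refine exists_injective_dihedralGroup (by omega) _
    (QuotientGroup.mk' (Subgroup.center SL(2, ZMod p)) w) hord ?_ ?_
  · rw [← map_mul, mk_eq_one_iff]
    right
    ext i j
    rw [Matrix.SpecialLinearGroup.coe_mul, hw]
    fin_cases i <;> fin_cases j <;> simp <;> grind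
  · rw [eq_inv_iff_mul_eq_one, ← map_mul, ← map_mul, ← map_mul, mk_eq_one_iff]
    right
    ext i j
    rw [Matrix.SpecialLinearGroup.coe_mul, hR', Matrix.SpecialLinearGroup.coe_mul,
      Matrix.SpecialLinearGroup.coe_mul, hR', hw]
    fin_cases i <;> fin_cases j <;> simp <;> grind

theorem self_mem_solubilizer {G : Type*} [Group G] [Finite G] (x : G) : x ∈ solubilizer x :=
  mem_solubilizer_of_conj_mem (Subgroup.zpowers x) inferInstance
    (fun _ hk => mul_mem (mul_mem (Subgroup.mem_zpowers x) hk)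
      (inv_mem (Subgroup.mem_zpowers x))) (Subgroup.mem_zpowers x)

theorem nonempty_mulEquiv_dihedralGroup {p : ℕ} [Fact p.Prime] (hp : 5 ≤ p) {n : ℕ}
    (hn : p + 1 = 2 ^ n) (x : PSL(2, ZMod p)) (S : Subgroup PSL(2, ZMod p))
    (hS : (S : Set PSL(2, ZMod p)) = solubilizer x) (h2 : IsPGroup 2 S) :
    Nonempty (S ≃* DihedralGroup ((p + 1) / 2)) := by
  have hn3 : 3 ≤ n := by
    by_contra h
    interval_cases n <;> omega
  obtain ⟨k, rfl⟩ : ∃ k, n = k + 3 := ⟨n - 3, by omega⟩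
  rw [pow_add] at hn
  obtain ⟨f, hf⟩ := exists_injective_dihedralGroup_psl (p := p) hp (by omega)
  have hN : Nat.card f.range = 2 ^ (k + 3) := by
    rw [← Nat.card_congr (MonoidHom.ofInjective hf).toEquiv, DihedralGroup.nat_card, pow_add]
    omega
  have hidx : ¬ 2 ∣ f.range.index := by
    have h1 := card_projectiveSpecialLinearGroup_two p (by omega)
    rw [← f.range.card_mul_index, hN] at h1
    replace h1 := h1.trans (congrArg _ hn)
    obtain ⟨q, hq⟩ : ∃ q, p = 4 * q + 3 := ⟨p / 4, by omega⟩
    have h3 : f.range.index = p * (2 * q + 1) := by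
      apply Nat.eq_of_mul_eq_mul_left (show 0 < 2 ^ k * 2 ^ 3 * 2 by positivity)
      rw [show p - 1 = 2 * (2 * q + 1) by omega] at h1
      rw [pow_add] at h1
      linarith
    rw [h3, Nat.prime_two.dvd_mul]
    omega
  let P : Sylow 2 PSL(2, ZMod p) := (IsPGroup.of_card hN).toSylow hidx
  obtain ⟨T, hT⟩ := h2.exists_le_sylow
  have hST : S = T := by
    refine le_antisymm hT fun y hy => ?_
    have hxT : x ∈ (T : Subgroup PSL(2, ZMod p)) := by
      apply hT
      rw [← SetLike.mem_coe, hS]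
      exact self_mem_solubilizer x
    rw [← SetLike.mem_coe, hS]
    have : Group.IsNilpotent (T : Subgroup PSL(2, ZMod p)) := T.2.isNilpotent
    exact mem_solubilizer_of_conj_mem T inferInstance
      (fun k hk => mul_mem (mul_mem hxT hk) (inv_mem hxT)) hy
  rw [hST]
  exact ⟨(T.equiv P).trans (MonoidHom.ofInjective hf).symm⟩

theorem coe_mul_self {F : Type*} [Field F] (B : SL(2, F)) :
    B.1 * B.1 = (B 0 0 + B 1 1) • B.1 - 1 := by
  have hdet := B.det_coe
  rw [Matrix.det_fin_two] at hdet
  ext i j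
  rw [Matrix.mul_apply, Fin.sum_univ_two]
  fin_cases i <;> fin_cases j <;> simp <;> grind

theorem exists_trace_eq {F : Type*} [Field F] (A : SL(2, F)) (hc : A 1 0 ≠ 0) (α γ : F)
    (h : γ ^ 2 + (A 0 0 + A 1 1) * γ * (1 + α) + α ^ 2 + α + 1 = 0) :
    ∃ C : SL(2, F), C 0 0 + C 1 1 = -1 ∧ (A * C) 0 0 + (A * C) 1 1 = 0 := by
  have hdet := A.det_coe
  rw [Matrix.det_fin_two] at hdet
  generalize hcc : A 1 0 = c at hc hdet
  obtain ⟨β, hβ⟩ : ∃ β, β = γ + (A 0 0 + A 1 1) * (1 + α) := ⟨_, rfl⟩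
  obtain ⟨C, hC⟩ : ∃ C : SL(2, F), C.1 =
      !![α + A 0 0 * γ, (β + A 0 0 * (-1 - α) - A 0 0 * (α + A 0 0 * γ)) / c;
        c * γ, -1 - α - A 0 0 * γ] := by
    refine ⟨⟨_, ?_⟩, rfl⟩
    rw [Matrix.det_fin_two_of]
    field_simp
    rw [hβ]
    linear_combination -h
  refine ⟨C, by simp [hC], ?_⟩
  · rw [Matrix.SpecialLinearGroup.coe_mul, Matrix.mul_apply, Matrix.mul_apply, Fin.sum_univ_two,
      Fin.sum_univ_two]
    simp [hC, hcc]
    field_simp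
    rw [hβ]
    linear_combination (-γ) * hdet

theorem eight_le_orderOf {p : ℕ} [Fact p.Prime] (hp : 5 ≤ p) (A : SL(2, ZMod p))
    (hA : ∀ r : ZMod p, r ^ 2 - (A 0 0 + A 1 1) * r + 1 ≠ 0)
    (hx : ∀ y ∈ solubilizer (QuotientGroup.mk' (Subgroup.center SL(2, ZMod p)) A),
      ∃ n : ℕ, y ^ 2 ^ n = 1) :
    8 ≤ orderOf (QuotientGroup.mk' (Subgroup.center SL(2, ZMod p)) A) := by
  have hne : ∀ q : ℕ, q.Prime → q < 5 → (q : ZMod p) ≠ 0 := fun q hq h5 => by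
    rw [Ne, ZMod.natCast_eq_zero_iff, Nat.prime_dvd_prime_iff_eq Fact.out hq]
    omega
  have h2 : (2 : ZMod p) ≠ 0 := by exact_mod_cast hne 2 Nat.prime_two (by omega)
  have h3 : (3 : ZMod p) ≠ 0 := by exact_mod_cast hne 3 Nat.prime_three (by omega)
  by_contra hlt
  have hx4 : QuotientGroup.mk' (Subgroup.center SL(2, ZMod p)) A ^ 4 = 1 := by
    obtain ⟨n, hn⟩ := hx _ (self_mem_solubilizer _)
    obtain ⟨k, -, hk⟩ := (Nat.dvd_prime_pow Nat.prime_two).1 (orderOf_dvd_of_pow_eq_one hn)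
    have hk3 : k < 3 := by
      by_contra h
      have := Nat.pow_le_pow_right two_pos (not_lt.1 h)
      omega
    rw [← orderOf_dvd_iff_pow_eq_one, hk]
    exact pow_dvd_pow 2 (show k ≤ 2 by omega)
  have hc : A 1 0 ≠ 0 := by
    intro h
    have hdet := A.det_coe
    rw [Matrix.det_fin_two, h] at hdet
    apply hA (A 0 0)
    linear_combination -hdet
  have hA4 : (A ^ 4) 1 0 = 0 := by
    rw [← map_pow, mk_eq_one_iff] at hx4
    rcases hx4 with h | h <;> rw [h] <;> simp
  set t := A 0 0 + A 1 1 with ht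
  have ht' : t = 0 ∨ t ^ 2 = 2 := by
    have e : (A ^ 4).1 = (t ^ 3 - 2 * t) • A.1 + (1 - t ^ 2) • 1 := by
      have h1 := coe_mul_self A
      rw [← ht] at h1
      have : (A ^ 4).1 = (A.1 * A.1) * (A.1 * A.1) := by
        rw [Matrix.SpecialLinearGroup.coe_pow]; noncomm_ring
      rw [this, h1]
      simp only [sub_mul, mul_sub, smul_mul_assoc, mul_smul_comm, h1, one_mul, mul_one]
      module
    rw [e] at hA4
    simp at hA4
    rcases hA4 with h | h
    · rcases eq_or_ne t 0 with h0 | h0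
      · exact Or.inl h0
      · right
        apply mul_left_cancel₀ h0
        linear_combination h
    · exact absurd h hc
  have hex : ∃ α γ : ZMod p, γ ^ 2 + t * γ * (1 + α) + α ^ 2 + α + 1 = 0 := by
    rcases ht' with h | h
    · obtain ⟨u, v, huv⟩ := ZMod.sq_add_sq p (-3 / 4)
      refine ⟨v - 1 / 2, u, ?_⟩
      have h4 : (4 : ZMod p) ≠ 0 := by
        have : (4 : ZMod p) = 2 * 2 := by norm_num
        rw [this]; exact mul_ne_zero h2 h2
      rw [h]
      field_simp at huv ⊢
      linear_combination huv
    · obtain ⟨u, v, huv⟩ := ZMod.sq_add_sq p (-1)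
      refine ⟨v, (u * t - t * (1 + v)) / 2, ?_⟩
      field_simp
      linear_combination 2 * huv + (u ^ 2 - (1 + v) ^ 2) * h
  obtain ⟨α, γ, hαγ⟩ := hex
  obtain ⟨C, hC1, hC2⟩ := exists_trace_eq A hc α γ hαγ
  have hC3 : C ^ 3 = 1 := by
    apply Subtype.ext
    have h1 := coe_mul_self C
    rw [hC1] at h1
    have : (C ^ 3).1 = (C.1 * C.1) * C.1 := by
      rw [Matrix.SpecialLinearGroup.coe_pow]; noncomm_ring
    rw [this, h1, sub_mul, smul_mul_assoc, h1]
    simp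
  have hAC : (A * C) ^ 2 = -1 := by
    apply Subtype.ext
    have h1 := coe_mul_self (A * C)
    rw [hC2] at h1
    rw [Matrix.SpecialLinearGroup.coe_pow, sq, h1]
    simp
  have hC3' : QuotientGroup.mk' (Subgroup.center SL(2, ZMod p)) C ^ 3 = 1 := by
    rw [← map_pow, hC3, map_one]
  obtain ⟨n, hn⟩ := hx _ (mem_solubilizer_of_octahedral hx4 hC3' (by
    rw [← map_mul, ← map_pow, mk_eq_one_iff]
    exact Or.inr hAC))
  have hone : QuotientGroup.mk' (Subgroup.center SL(2, ZMod p)) C = 1 := by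
    rw [← orderOf_eq_one_iff]
    have := Nat.dvd_gcd (orderOf_dvd_of_pow_eq_one hC3') (orderOf_dvd_of_pow_eq_one hn)
    rw [(Nat.Coprime.pow_right n (by norm_num : Nat.Coprime 3 2)).gcd_eq_one] at this
    exact Nat.dvd_one.1 this
  rw [mk_eq_one_iff] at hone
  rcases hone with rfl | rfl
  · simp at hC1
    apply h3
    linear_combination hC1
  · simp at hC1

theorem isDihedral_of_solubilizer_psl_two {p : ℕ} [Fact p.Prime] (hp : 5 ≤ p) (x : PSL(2, ZMod p))
    (S : Subgroup PSL(2, ZMod p)) (hS : (S : Set PSL(2, ZMod p)) = solubilizer x)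
    (h2 : IsPGroup 2 S) :
    31 ≤ p ∧ (∃ n : ℕ, p = 2 ^ n - 1) ∧ 8 ≤ orderOf x ∧
      Nonempty (S ≃* DihedralGroup ((p + 1) / 2)) := by
  obtain ⟨A, rfl⟩ := QuotientGroup.mk'_surjective (Subgroup.center SL(2, ZMod p)) x
  have hx : ∀ y ∈ solubilizer (QuotientGroup.mk' (Subgroup.center SL(2, ZMod p)) A),
      ∃ n : ℕ, y ^ 2 ^ n = 1 := by
    intro y hy
    rw [← hS] at hy
    obtain ⟨n, hn⟩ := h2 ⟨y, hy⟩
    exact ⟨n, congrArg Subtype.val hn⟩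
  have hA := exists_pow_eq_one_of_mk hx
  obtain ⟨n, hn⟩ := exists_add_one_eq_two_pow (by omega) A hA
  have h8 := eight_le_orderOf hp A (sq_sub_trace_mul_add_one_ne_zero (by omega) A hA) hx
  obtain ⟨e⟩ := nonempty_mulEquiv_dihedralGroup hp hn _ S hS h2
  refine ⟨?_, ⟨n, by omega⟩, h8, ⟨e⟩⟩
  by_contra hlt
  have hn5 : n < 5 := by
    by_contra h
    have := Nat.pow_le_pow_right two_pos (not_lt.1 h)
    omega
  have h7 : p = 7 := by
    have hpp := (Fact.out : p.Prime)
    interval_cases n <;> try omega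
    obtain rfl : p = 15 := by omega
    norm_num at hpp
  subst h7
  have hAS : QuotientGroup.mk' (Subgroup.center SL(2, ZMod 7)) A ∈ S := by
    rw [← SetLike.mem_coe, hS]
    exact self_mem_solubilizer _
  have hD : ∀ g : DihedralGroup ((7 + 1) / 2), g ^ 4 = 1 := by decide
  have h4 : (⟨_, hAS⟩ : S) ^ 4 = 1 := by
    apply e.injective
    rw [map_pow, hD, map_one]
  have := orderOf_le_of_pow_eq_one (by norm_num) (congrArg Subtype.val h4)
  simp only at this
  omega

theorem isSolvable_sl_two_two : Group.IsSolvable SL(2, ZMod 2) := by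
  let Y : SL(2, ZMod 2) := ⟨!![0, 1; 1, 1], by decide⟩
  let S : SL(2, ZMod 2) := ⟨!![0, 1; 1, 0], by decide⟩
  have hs : S * Y * S⁻¹ = Y ^ 2 := by decide
  have hall : ∀ A : SL(2, ZMod 2), ∃ i : Fin 3, ∃ j : Fin 2, A = Y ^ i.1 * S ^ j.1 := by
    decide +kernel
  have h := isSolvable_sup_zpowers (Subgroup.zpowers Y) inferInstance S ?_
  · have htop : Subgroup.zpowers Y ⊔ Subgroup.zpowers S = ⊤ := by
      rw [eq_top_iff]
      intro A _
      obtain ⟨i, j, rfl⟩ := hall A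
      exact mul_mem (pow_mem (Subgroup.mem_sup_left (Subgroup.mem_zpowers _)) _)
        (pow_mem (Subgroup.mem_sup_right (Subgroup.mem_zpowers _)) _)
    rw [htop] at h
    exact Group.isSolvable_of_surjective (f := (⊤ : Subgroup SL(2, ZMod 2)).subtype)
      fun a => ⟨⟨a, trivial⟩, rfl⟩
  · rintro _ ⟨k, rfl⟩
    change S * Y ^ k * S⁻¹ ∈ _
    rw [← conj_zpow, hs]
    exact zpow_mem (pow_mem (Subgroup.mem_zpowers _) _) _

theorem isSolvable_psl_two_three : Group.IsSolvable PSL(2, ZMod 3) := by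
  let I : SL(2, ZMod 3) := ⟨!![0, 1; -1, 0], by decide⟩
  let J : SL(2, ZMod 3) := ⟨!![1, 1; 1, -1], by decide⟩
  let T : SL(2, ZMod 3) := ⟨!![1, 1; 0, 1], by decide⟩
  let π := QuotientGroup.mk' (Subgroup.center SL(2, ZMod 3))
  have hneg : ∀ A, π (-A) = π A := fun A => by
    have h : -A = -1 * A := by simp
    rw [h, map_mul, mk_eq_one_iff.2 (Or.inr rfl), one_mul]
  have h1 : J * I = -(I * J) := by decide
  have h2 : T * I * T⁻¹ = -J := by decide
  have h3 : T * J * T⁻¹ = -(I * J) := by decide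
  have hall : ∀ A : SL(2, ZMod 3), ∃ a b : Fin 2, ∃ c : Fin 3,
      A = I ^ a.1 * J ^ b.1 * T ^ c.1 ∨ A = -(I ^ a.1 * J ^ b.1 * T ^ c.1) := by
    decide +kernel
  have hcomm : π J * π I = π I * π J := by rw [← map_mul, h1, hneg, map_mul]
  let V := Subgroup.closure ({π I, π J} : Set PSL(2, ZMod 3))
  have hIV : π I ∈ V := Subgroup.subset_closure (by simp)
  have hJV : π J ∈ V := Subgroup.subset_closure (by simp)
  have hV : Group.IsSolvable V := by
    have : IsMulCommutative V := by
      refine Subgroup.isMulCommutative_closure ?_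
      rintro u (rfl | rfl) v (rfl | rfl) <;> first | rfl | exact hcomm | exact hcomm.symm
    exact Group.isSolvable_of_comm fun u v => mul_comm' u v
  have h := isSolvable_sup_zpowers V hV (π T) ?_
  · have htop : V ⊔ Subgroup.zpowers (π T) = ⊤ := by
      rw [eq_top_iff]
      intro y _
      obtain ⟨A, rfl⟩ := QuotientGroup.mk'_surjective _ y
      have hm : ∀ a b c : ℕ, π (I ^ a * J ^ b * T ^ c) ∈ V ⊔ Subgroup.zpowers (π T) := by
        intro a b c
        rw [map_mul, map_mul, map_pow, map_pow, map_pow]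
        exact mul_mem (Subgroup.mem_sup_left (mul_mem (pow_mem hIV _) (pow_mem hJV _)))
          (pow_mem (Subgroup.mem_sup_right (Subgroup.mem_zpowers _)) _)
      obtain ⟨a, b, c, rfl | rfl⟩ := hall A
      · exact hm _ _ _
      · change π _ ∈ _
        rw [hneg]
        exact hm _ _ _
    rw [htop] at h
    exact Group.isSolvable_of_surjective (f := (⊤ : Subgroup PSL(2, ZMod 3)).subtype)
      fun a => ⟨⟨a, trivial⟩, rfl⟩
  · intro k hk
    have : V ≤ V.comap (MulAut.conj (π T)).toMonoidHom := by
      rw [Subgroup.closure_le]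
      rintro z (rfl | rfl)
      · change π T * π I * (π T)⁻¹ ∈ V
        rw [← map_inv, ← map_mul, ← map_mul, h2, hneg]
        exact hJV
      · change π T * π J * (π T)⁻¹ ∈ V
        rw [← map_inv, ← map_mul, ← map_mul, h3, hneg, map_mul]
        exact mul_mem hIV hJV
    exact this hk

theorem isSolvable_psl_two_of_lt_five {p : ℕ} (hp : p.Prime) (h5 : p < 5) :
    Group.IsSolvable PSL(2, ZMod p) := by
  interval_cases p
  · exact absurd hp (by norm_num)
  · exact absurd hp (by norm_num)
  · have := isSolvable_sl_two_two
    exact Group.isSolvable_of_surjective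
      (QuotientGroup.mk'_surjective (Subgroup.center SL(2, ZMod 2)))
  · exact isSolvable_psl_two_three
  · exact absurd hp (by norm_num)

theorem isSolvable_of_map_mk {G : Type*} [Group G] (K : Subgroup G) [K.Normal]
    (hK : Group.IsSolvable K) (H : Subgroup G)
    (h : Group.IsSolvable (H.map (QuotientGroup.mk' K))) : Group.IsSolvable H := by
  have : Group.IsSolvable ↥(K ⊓ H) := isSolvable_of_le inf_le_left hK
  refine Group.isSolvable_of_ker_le_range (Subgroup.inclusion (inf_le_right : K ⊓ H ≤ H))
    ((QuotientGroup.mk' K).subgroupMap H) fun y hy => ?_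
  exact ⟨⟨y.1, (QuotientGroup.eq_one_iff y.1).1 (congrArg Subtype.val hy), y.2⟩, rfl⟩

theorem isSolvable_sup {G : Type*} [Group G] (K M : Subgroup G) [K.Normal]
    (hK : Group.IsSolvable K) (hM : Group.IsSolvable M) : Group.IsSolvable ↥(K ⊔ M) := by
  refine isSolvable_of_map_mk K hK _ ?_
  rw [Subgroup.map_sup, (Subgroup.map_eq_bot_iff K).2 (QuotientGroup.ker_mk' K).ge, bot_sup_eq]
  exact Group.isSolvable_of_surjective ((QuotientGroup.mk' K).subgroupMap_surjective M)

theorem isSolvable_solubleRadical (G : Type*) [Group G] [Finite G] :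
    Group.IsSolvable (solubleRadical G) := by
  have key : ∀ s : Set (Subgroup G), s.Finite → (∀ N ∈ s, N.Normal ∧ Group.IsSolvable N) →
      Group.IsSolvable (sSup s : Subgroup G) := by
    intro s hs
    induction s, hs using Set.Finite.induction_on with
    | empty =>
      intro _
      rw [sSup_empty]
      infer_instance
    | @insert N s _ _ ih =>
      intro h
      have hN := h N (Set.mem_insert _ _)
      have := hN.1
      rw [sSup_insert]
      exact isSolvable_sup N _ hN.2 (ih fun M hM => h M (Set.mem_insert_of_mem _ hM))
  exact key _ (Set.toFinite _) fun N hN => hN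

theorem mem_solubilizer_of_mk_mem {G : Type*} [Group G] (K : Subgroup G) [K.Normal]
    (hK : Group.IsSolvable K) {x y : G}
    (h : QuotientGroup.mk' K y ∈ solubilizer (QuotientGroup.mk' K x)) : y ∈ solubilizer x := by
  refine isSolvable_of_map_mk K hK _ ?_
  rw [MonoidHom.map_closure, Set.image_pair]
  exact h

theorem isSolvable_pi {ι : Type*} [Finite ι] (H : ι → Type*) [∀ i, Group (H i)]
    (h : ∀ i, Group.IsSolvable (H i)) : Group.IsSolvable (∀ i, H i) := by
  choose n hn using fun i => (Group.isSolvable_def (H i)).1 (h i)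
  obtain ⟨N, hN⟩ := (Set.finite_range n).bddAbove
  refine (Group.isSolvable_def _).2 ⟨N, ?_⟩
  rw [eq_bot_iff]
  intro f hf
  rw [Subgroup.mem_bot]
  ext i
  have h1 := map_derivedSeries_le_derivedSeries (Pi.evalMonoidHom H i) N ⟨f, hf, rfl⟩
  have h2 := derivedSeries_antitone (H i) (hN ⟨i, rfl⟩) h1
  rw [hn i] at h2
  exact h2

theorem mem_solubilizer_pi {ι : Type*} [Finite ι] {H : ι → Type*} [∀ i, Group (H i)]
    {x y : ∀ i, H i} (h : ∀ i, y i ∈ solubilizer (x i)) : y ∈ solubilizer x := by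
  let P := Subgroup.pi Set.univ fun i => Subgroup.closure ({x i, y i} : Set (H i))
  have hP : Group.IsSolvable P := by
    have := isSolvable_pi (fun i => Subgroup.closure ({x i, y i} : Set (H i))) h
    refine Group.isSolvable_of_isSolvable_injective (f := (MonoidHom.pi fun i =>
      ((Pi.evalMonoidHom H i).comp P.subtype).codRestrict
        (Subgroup.closure ({x i, y i} : Set (H i))) fun a => a.2 i trivial)) fun a b hab => ?_
    ext i
    exact congrArg Subtype.val (congrFun hab i)
  refine isSolvable_of_le (K := P) ?_ hP
  rw [Subgroup.closure_le]
  rintro z (rfl | rfl) i -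
  · exact Subgroup.subset_closure (by simp)
  · exact Subgroup.subset_closure (by simp)

theorem stmt_14 {G : Type*} [Group G] [Finite G] (hG : ¬ IsSolvable G)
    (x : G) (Q : Subgroup G) (hQ : (Q : Set G) = solubilizer x)
    (h2 : ∃ n : ℕ, Nat.card Q = 2 ^ n)
    (ℓ : ℕ) (hℓ : 1 ≤ ℓ) (p : ℕ) (hp : p.Prime)
    (hiso : Nonempty ((G ⧸ solubleRadical G) ≃* (Fin ℓ → PSL(2, ZMod p)))) :
    31 ≤ p ∧ (∃ n : ℕ, p = 2 ^ n - 1) ∧ 8 ≤ orderOf x ∧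
      Nonempty ((Q.map (QuotientGroup.mk' (solubleRadical G))) ≃*
        (Fin ℓ → DihedralGroup ((p + 1) / 2))) := by
  have : Fact p.Prime := ⟨hp⟩
  obtain ⟨e⟩ := hiso
  have hR := isSolvable_solubleRadical G
  have hp5 : 5 ≤ p := by
    by_contra hlt
    have h1 := isSolvable_psl_two_of_lt_five hp (not_le.1 hlt)
    have := isSolvable_pi (fun _ : Fin ℓ => PSL(2, ZMod p)) fun _ => h1
    have : Group.IsSolvable (G ⧸ solubleRadical G) :=
      Group.isSolvable_of_isSolvable_injective (f := e.toMonoidHom) e.injective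
    exact hG (Group.isSolvable_of_ker_le_range (solubleRadical G).subtype
      (QuotientGroup.mk' (solubleRadical G)) (by simp))
  obtain ⟨n, hn⟩ := h2
  let q := QuotientGroup.mk' (solubleRadical G)
  let f : Fin ℓ → (G ⧸ solubleRadical G) →* PSL(2, ZMod p) := fun i =>
    (Pi.evalMonoidHom (fun _ => PSL(2, ZMod p)) i).comp e.toMonoidHom
  have hmem : ∀ y : G, (∀ i, f i (q y) ∈ solubilizer (f i (q x))) → y ∈ Q := by
    intro y hy
    rw [← SetLike.mem_coe, hQ]
    apply mem_solubilizer_of_mk_mem _ hR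
    have h1 := map_mem_solubilizer e.symm.toMonoidHom
      (mem_solubilizer_pi (x := e (q x)) (y := e (q y)) hy)
    simp only [MulEquiv.toMonoidHom_eq_coe, MonoidHom.coe_coe, MulEquiv.symm_apply_apply] at h1
    exact h1
  have hS : ∀ i, (((Q.map q).map (f i) : Subgroup PSL(2, ZMod p)) : Set PSL(2, ZMod p)) =
      solubilizer (f i (q x)) := by
    intro i
    ext z
    constructor
    · rintro ⟨_, ⟨y, hy, rfl⟩, rfl⟩
      rw [hQ] at hy
      exact map_mem_solubilizer (f i) (map_mem_solubilizer q hy)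
    · intro hz
      obtain ⟨y, hy⟩ := QuotientGroup.mk'_surjective (solubleRadical G)
        (e.symm (Function.update (e (q x)) i z))
      have hfy : ∀ j, f j (q y) = Function.update (e (q x)) i z j := by
        intro j
        change e (q y) j = _
        rw [show q y = _ from hy, e.apply_symm_apply]
      refine ⟨q y, ⟨y, hmem y fun j => ?_, rfl⟩, by rw [hfy, Function.update_self]⟩
      rw [hfy]
      rcases eq_or_ne j i with rfl | hj
      · rwa [Function.update_self]
      · rw [Function.update_of_ne hj]
        exact self_mem_solubilizer _
  have main := fun i => isDihedral_of_solubilizer_psl_two hp5 (f i (q x)) _ (hS i)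
    (((IsPGroup.of_card hn).map q).map (f i))
  obtain ⟨h31, hM, h8, -⟩ := main ⟨0, hℓ⟩
  refine ⟨h31, hM, h8.trans ?_, ?_⟩
  · exact Nat.le_of_dvd (orderOf_pos x)
      ((orderOf_map_dvd (f ⟨0, hℓ⟩) (q x)).trans (orderOf_map_dvd q x))
  · let g : Q.map q →* ∀ i, (Q.map q).map (f i) := MonoidHom.pi fun i => (f i).subgroupMap _
    have hg : Function.Bijective g := by
      constructor
      · intro a b hab
        apply Subtype.ext
        apply e.injective
        ext i
        exact congrArg Subtype.val (congrFun hab i)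
      · intro s
        obtain ⟨y, hy⟩ := QuotientGroup.mk'_surjective (solubleRadical G)
          (e.symm fun i => (s i).1)
        have hfy : ∀ j, f j (q y) = s j := by
          intro j
          change e (q y) j = _
          rw [show q y = _ from hy, e.apply_symm_apply]
        refine ⟨⟨q y, y, hmem y fun i => ?_, rfl⟩, ?_⟩
        · rw [hfy, ← hS]
          exact (s i).2
        · ext i
          exact hfy i
    exact ⟨(MulEquiv.ofBijective g hg).trans
      (MulEquiv.piCongrRight fun i => (main i).2.2.2.some)⟩
end
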